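/- arXiv:2401.06100 — 3 statements merged into one kernel-verified Lean document; each statement's English description precedes it below -/
import Mathlib

section
/- Let p be an odd prime, K a finite extension of ℚ_p with ring of integers O and valuation v_p normalized so that v_p(p) = 1. Let F ∈ O[[T]] be a power series with vanishing μ-invariant and λ-invariant λ(F). Let t₀ ∈ O with v_p(t₀) > 0, let a_j denote the j-th Taylor coefficient of F at t₀ (the j-th coefficient of F(T + t₀)), let p_m(T) = a_0 + a_1(T − t₀) + ⋯ + a_m(T − t₀)^m denote the m-th Taylor polynomial of F at t₀, and let b ∈ O satisfy v_p(b − t₀) = 1. Then for every integer n > 0: λ(F) > n if and only if λ(F) > n − 1 and v_p(F(b) − p_{n−1}(b)) > n. -/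
/-- The λ-invariant: least index `j` with `c j` a unit of the ring of integers,
i.e. `‖c j‖ = 1`. -/
noncomputable def lambdaInvariant {K : Type*} [NormedField K] (c : ℕ → K) : ℕ :=
  sInf {j | ‖c j‖ = 1}

/-- The `j`-th Taylor coefficient of the power series with coefficients `c` expanded
around `t₀`, i.e. the `j`-th coefficient of `F(T + t₀)`. -/
noncomputable def taylorCoeff {K : Type*} [NormedField K] [CompleteSpace K]
    (c : ℕ → K) (t₀ : K) (j : ℕ) : K :=
  ∑' i : ℕ, c (j + i) * ((j + i).choose j : K) * t₀ ^ i

/-- The value at `x` of the `m`-th Taylor polynomial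
`p_m(T) = a_0 + a_1 (T - t₀) + ⋯ + a_m (T - t₀)^m` of `F` at `t₀`. -/
noncomputable def taylorPolyEval {K : Type*} [NormedField K] [CompleteSpace K]
    (c : ℕ → K) (t₀ : K) (m : ℕ) (x : K) : K :=
  ∑ j ∈ Finset.range (m + 1), taylorCoeff c t₀ j * (x - t₀) ^ j

/-- A summable family indexed by `ℕ × ℕ` can be summed along antidiagonals. -/
lemma tsum_prod_eq_tsum_sum_antidiagonal {E : Type*} [NormedAddCommGroup E] [CompleteSpace E]
    {f : ℕ × ℕ → E} (hf : Summable f) :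
    ∑' q, f q = ∑' k, ∑ q ∈ Finset.HasAntidiagonal.antidiagonal k, f q := by
  let e := Finset.HasAntidiagonal.sigmaAntidiagonalEquivProd (A := ℕ)
  have hσ : Summable fun s => f (e s) := e.summable_iff.mpr hf
  rw [← e.tsum_eq f, hσ.tsum_sigma]
  exact tsum_congr fun k => Finset.tsum_subtype (Finset.HasAntidiagonal.antidiagonal k) f

lemma summable_mul_pow_of_norm_le_one {K : Type*} [NormedField K] [CompleteSpace K]
    {u : ℕ → K} (hu : ∀ i, ‖u i‖ ≤ 1) {x : K} (hx : ‖x‖ < 1) :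
    Summable fun i => u i * x ^ i := by
  refine Summable.of_norm_bounded (summable_geometric_of_lt_one (norm_nonneg x) hx) fun i => ?_
  rw [norm_mul, norm_pow]
  exact mul_le_of_le_one_left (by positivity) (hu i)

section Ultrametric

variable {K : Type*} [NormedField K] [IsUltrametricDist K]

/-- A power series with integral coefficients is bounded by one on the open unit disc. -/
lemma norm_tsum_mul_pow_le_one {u : ℕ → K} (hu : ∀ i, ‖u i‖ ≤ 1) {x : K} (hx : ‖x‖ < 1) :
    ‖∑' i, u i * x ^ i‖ ≤ 1 := by
  refine IsUltrametricDist.norm_tsum_le_of_forall_le_of_nonneg zero_le_one fun i => ?_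
  rw [norm_mul, norm_pow]
  exact mul_le_one₀ (hu i) (by positivity) (pow_le_one₀ (norm_nonneg x) hx.le)

lemma norm_mul_choose_le_one {c : ℕ → K} (hc : ∀ j, ‖c j‖ ≤ 1) (j i : ℕ) :
    ‖c (j + i) * ((j + i).choose j : K)‖ ≤ 1 := by
  rw [norm_mul]
  exact mul_le_one₀ (hc _) (norm_nonneg _) (IsUltrametricDist.norm_natCast_le_one K _)

variable [CompleteSpace K]

/-- On the open unit disc, a power series with integral coefficients takes a value in the maximal
ideal if and only if its constant term lies there. -/
lemma norm_tsum_mul_pow_lt_one_iff {u : ℕ → K} (hu : ∀ i, ‖u i‖ ≤ 1) {x : K} (hx : ‖x‖ < 1) :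
    ‖∑' i, u i * x ^ i‖ < 1 ↔ ‖u 0‖ < 1 := by
  have hs : ∑' i, u i * x ^ i = u 0 + x * ∑' i, u (i + 1) * x ^ i := by
    rw [(summable_mul_pow_of_norm_le_one hu hx).tsum_eq_zero_add, ← tsum_mul_left]
    simp [pow_succ', mul_left_comm]
  have hr : ‖x * ∑' i, u (i + 1) * x ^ i‖ < 1 := by
    rw [norm_mul]
    exact (mul_le_of_le_one_right (norm_nonneg x)
      (norm_tsum_mul_pow_le_one (fun i => hu (i + 1)) hx)).trans_lt hx
  rw [hs]
  constructor
  · intro h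
    have h' := IsUltrametricDist.norm_add_le_max (u 0 + x * ∑' i, u (i + 1) * x ^ i)
      (-(x * ∑' i, u (i + 1) * x ^ i))
    rw [add_neg_cancel_right, norm_neg] at h'
    exact h'.trans_lt (max_lt h hr)
  · exact fun h => (IsUltrametricDist.norm_add_le_max _ _).trans_lt (max_lt h hr)

lemma norm_taylorCoeff_le_one {c : ℕ → K} (hc : ∀ j, ‖c j‖ ≤ 1) {t : K} (ht : ‖t‖ < 1) (j : ℕ) :
    ‖taylorCoeff c t j‖ ≤ 1 :=
  norm_tsum_mul_pow_le_one (norm_mul_choose_le_one hc j) ht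

lemma norm_taylorCoeff_lt_one_iff {c : ℕ → K} (hc : ∀ j, ‖c j‖ ≤ 1) {t : K} (ht : ‖t‖ < 1)
    (j : ℕ) : ‖taylorCoeff c t j‖ < 1 ↔ ‖c j‖ < 1 := by
  simpa [taylorCoeff] using norm_tsum_mul_pow_lt_one_iff (norm_mul_choose_le_one hc j) ht

/-- Taylor expansion of a power series with integral coefficients around a point of the open unit
disc. -/
lemma tsum_taylorCoeff_mul_pow {c : ℕ → K} (hc : ∀ j, ‖c j‖ ≤ 1) {t d : K} (ht : ‖t‖ < 1)
    (hd : ‖d‖ < 1) : ∑' j, taylorCoeff c t j * d ^ j = ∑' k, c k * (d + t) ^ k := by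
  let f : ℕ × ℕ → K := fun q => c (q.1 + q.2) * ((q.1 + q.2).choose q.1 : K) * t ^ q.2 * d ^ q.1
  have hf : Summable f := by
    refine Summable.of_norm_bounded
      ((summable_geometric_of_lt_one (norm_nonneg d) hd).mul_of_nonneg
        (summable_geometric_of_lt_one (norm_nonneg t) ht)
        (fun _ => by positivity) (fun _ => by positivity)) fun q => ?_
    rw [norm_mul, norm_mul, norm_pow, norm_pow, mul_assoc, mul_comm (‖t‖ ^ q.2)]
    exact mul_le_of_le_one_left (by positivity) (norm_mul_choose_le_one hc q.1 q.2)
  calc ∑' j, taylorCoeff c t j * d ^ j = ∑' q, f q := by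
        rw [hf.tsum_prod]
        exact tsum_congr fun j => tsum_mul_right.symm
    _ = ∑' k, ∑ q ∈ Finset.HasAntidiagonal.antidiagonal k, f q :=
        tsum_prod_eq_tsum_sum_antidiagonal hf
    _ = ∑' k, c k * (d + t) ^ k := by
        refine tsum_congr fun k => ?_
        rw [(Commute.all d t).add_pow', Finset.mul_sum]
        refine Finset.sum_congr rfl fun q hq => ?_
        rw [← Finset.HasAntidiagonal.mem_antidiagonal.mp hq, nsmul_eq_mul]
        simp only [f]
        ring

/-- The Taylor remainder is `d ^ n` times a power series in `d` starting at the `n`-th Taylor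
coefficient. -/
lemma tsum_sub_sum_taylorCoeff {c : ℕ → K} (hc : ∀ j, ‖c j‖ ≤ 1) {t d : K} (ht : ‖t‖ < 1)
    (hd : ‖d‖ < 1) (n : ℕ) :
    ∑' k, c k * (d + t) ^ k - ∑ j ∈ Finset.range n, taylorCoeff c t j * d ^ j =
      d ^ n * ∑' j, taylorCoeff c t (j + n) * d ^ j := by
  rw [← tsum_taylorCoeff_mul_pow hc ht hd, ← (summable_mul_pow_of_norm_le_one
    (norm_taylorCoeff_le_one hc ht) hd).sum_add_tsum_nat_add n, add_sub_cancel_left,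
    ← tsum_mul_left]
  exact tsum_congr fun j => by ring

end Ultrametric

lemma lt_lambdaInvariant_iff {K : Type*} [NormedField K] {c : ℕ → K} (hμ : ∃ j, ‖c j‖ = 1)
    (n : ℕ) : n < lambdaInvariant c ↔ ∀ j ≤ n, ‖c j‖ ≠ 1 := by
  constructor
  · exact fun h j hj hcj => (Nat.sInf_le hcj).not_gt (hj.trans_lt h)
  · intro h
    by_contra! hle
    exact h _ hle (Nat.sInf_mem (s := {j | ‖c j‖ = 1}) hμ)

/-- Let `p` be an odd prime, `K` a finite extension of `ℚ_p` with ring of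
integers `O = {x | ‖x‖ ≤ 1}` and valuation normalized so that `v_p(p) = 1` (encoded via
the norm: `v_p(x) > r ↔ ‖x‖ < p^{-r}`).  Let `F ∈ O[[T]]` have vanishing μ-invariant and
λ-invariant `λ(F)`, let `t₀ ∈ O` with `v_p(t₀) > 0`, let `p_m` be the `m`-th Taylor
polynomial of `F` at `t₀`, and let `b ∈ O` with `v_p(b - t₀) = 1`.  Then for every
integer `n > 0`:  `λ(F) > n` iff `λ(F) > n - 1` and `v_p(F(b) - p_{n-1}(b)) > n`. -/
theorem statement2
    (p : ℕ) (hp : p.Prime) (hodd : Odd p)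
    (K : Type*) [NormedField K] [CompleteSpace K] [IsUltrametricDist K]
    [hpfact : Fact p.Prime] [Algebra ℚ_[p] K] [FiniteDimensional ℚ_[p] K]
    (hnorm : ∀ x : ℚ_[p], ‖algebraMap ℚ_[p] K x‖ = ‖x‖)
    (c : ℕ → K) (hc : ∀ j, ‖c j‖ ≤ 1) (hμ : ∃ j, ‖c j‖ = 1)
    (t₀ : K) (ht₀ : ‖t₀‖ < 1)
    (b : K) (hbt₀ : ‖b - t₀‖ = (p : ℝ)⁻¹)
    (n : ℕ) (hn : 0 < n) :
    n < lambdaInvariant c ↔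
      (n - 1 < lambdaInvariant c ∧
        ‖(∑' j : ℕ, c j * b ^ j) - taylorPolyEval c t₀ (n - 1) b‖ < (p : ℝ) ^ (-(n : ℤ))) := by
  have hp0 : (0 : ℝ) < p := Nat.cast_pos.mpr hp.pos
  have hd : ‖b - t₀‖ < 1 := hbt₀ ▸ inv_lt_one_of_one_lt₀ (Nat.one_lt_cast.mpr hp.one_lt)
  have hrem := tsum_sub_sum_taylorCoeff hc ht₀ hd n
  rw [sub_add_cancel] at hrem
  have key : ‖(∑' j : ℕ, c j * b ^ j) - taylorPolyEval c t₀ (n - 1) b‖ < (p : ℝ) ^ (-(n : ℤ)) ↔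
      ‖c n‖ ≠ 1 := by
    rw [taylorPolyEval, Nat.sub_add_cancel hn, hrem, norm_mul, norm_pow, hbt₀, zpow_neg,
      zpow_natCast, inv_pow, mul_lt_iff_lt_one_right (by positivity),
      norm_tsum_mul_pow_lt_one_iff (fun j => norm_taylorCoeff_le_one hc ht₀ (j + n)) hd,
      zero_add, norm_taylorCoeff_lt_one_iff hc ht₀, (hc n).lt_iff_ne]
  rw [key, lt_lambdaInvariant_iff hμ, lt_lambdaInvariant_iff hμ]
  refine ⟨fun h => ⟨fun j hj => h j (by omega), h n le_rfl⟩, fun h j hj => ?_⟩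
  rcases hj.eq_or_lt with rfl | hlt
  · exact h.2
  · exact h.1 j (by omega)
end

section
/- Let p be an odd prime, K a finite extension of ℚ_p with ring of integers O and valuation v_p normalized so that v_p(p) = 1. Let F ∈ O[[T]] be a power series with vanishing μ-invariant and λ-invariant λ(F), let F′ denote its formal derivative, let t₀ ∈ O with v_p(t₀) > 0, and let b ∈ O with v_p(b − t₀) = 1. Then λ(F) > 2 if and only if v_p(F(t₀)) > 0, v_p(F′(t₀)) > 0, and v_p(F(b) − F′(t₀)·(b − t₀) − F(t₀)) > 2. -/
/-- Evaluation `F(x) = Σ_j c_j x^j` of the power series with coefficients `c`. -/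
noncomputable def psEval {K : Type*} [NormedField K] [CompleteSpace K]
    (c : ℕ → K) (x : K) : K :=
  ∑' j : ℕ, c j * x ^ j

/-- Evaluation `F'(x) = Σ_j (j+1) c_{j+1} x^j` of the formal derivative. -/
noncomputable def psDerivEval {K : Type*} [NormedField K] [CompleteSpace K]
    (c : ℕ → K) (x : K) : K :=
  ∑' j : ℕ, ((j + 1 : ℕ) : K) * c (j + 1) * x ^ j

lemma summable_psEval {K : Type*} [NormedField K] [CompleteSpace K] {c : ℕ → K}
    (hc : ∀ j, ‖c j‖ ≤ 1) {x : K} (hx : ‖x‖ < 1) :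
    Summable fun j ↦ c j * x ^ j := by
  refine .of_norm_bounded (summable_geometric_of_lt_one (norm_nonneg x) hx) fun n ↦ ?_
  rw [norm_mul, norm_pow]
  exact mul_le_of_le_one_left (by positivity) (hc n)

lemma psDerivEval_eq_psEval {K : Type*} [NormedField K] [CompleteSpace K] (c : ℕ → K) (x : K) :
    psDerivEval c x = psEval (fun j ↦ ((j + 1 : ℕ) : K) * c (j + 1)) x := rfl

section PowerSeriesEstimates

variable {K : Type*} [NormedField K] [IsUltrametricDist K]

lemma norm_add_lt_iff_of_norm_lt {x y : K} {ρ : ℝ} (hy : ‖y‖ < ρ) :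
    ‖x + y‖ < ρ ↔ ‖x‖ < ρ := by
  constructor
  · intro h
    have := IsUltrametricDist.norm_add_le_max (x + y) (-y)
    rw [add_neg_cancel_right, norm_neg] at this
    exact this.trans_lt (max_lt h hy)
  · intro h
    exact (IsUltrametricDist.norm_add_le_max x y).trans_lt (max_lt h hy)

/-- The second-order Taylor remainder of `x ^ (n + 2)` at `t`, evaluated at `b`, is divisible by
`(b - t) ^ 2` with quotient homogeneous of degree `n` in `b` and `t`. -/
lemma norm_pow_taylor_remainder_le {t b : K} {r : ℝ} (ht : ‖t‖ ≤ r) (hb : ‖b‖ ≤ r) (n : ℕ) :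
    ‖b ^ (n + 2) - ((n + 2 : ℕ) : K) * t ^ (n + 1) * (b - t) - t ^ (n + 2)‖
      ≤ r ^ n * ‖b - t‖ ^ 2 := by
  have hr : 0 ≤ r := (norm_nonneg t).trans ht
  induction n with
  | zero =>
    rw [show b ^ (0 + 2) - ((0 + 2 : ℕ) : K) * t ^ (0 + 1) * (b - t) - t ^ (0 + 2)
      = (b - t) ^ 2 by push_cast; ring]
    simp
  | succ n ih =>
    rw [show b ^ (n + 1 + 2) - ((n + 1 + 2 : ℕ) : K) * t ^ (n + 1 + 1) * (b - t) - t ^ (n + 1 + 2)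
      = b * (b ^ (n + 2) - ((n + 2 : ℕ) : K) * t ^ (n + 1) * (b - t) - t ^ (n + 2))
        + ((n + 2 : ℕ) : K) * t ^ (n + 1) * (b - t) ^ 2 by push_cast; ring]
    refine (IsUltrametricDist.norm_add_le_max _ _).trans (max_le ?_ ?_)
    · rw [norm_mul, pow_succ' r, mul_assoc r]
      gcongr
    · rw [norm_mul, norm_mul, norm_pow, norm_pow]
      gcongr
      calc ‖((n + 2 : ℕ) : K)‖ * ‖t‖ ^ (n + 1) ≤ 1 * r ^ (n + 1) := by
            gcongr
            exact IsUltrametricDist.norm_natCast_le_one K _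
        _ = r ^ (n + 1) := one_mul _

lemma norm_natCast_mul_le_one {c : ℕ → K} (hc : ∀ j, ‖c j‖ ≤ 1) (n j : ℕ) :
    ‖(n : K) * c j‖ ≤ 1 := by
  rw [norm_mul]
  exact mul_le_one₀ (IsUltrametricDist.norm_natCast_le_one K n) (norm_nonneg _) (hc j)

variable [CompleteSpace K] {c : ℕ → K}

lemma norm_psEval_le (hc : ∀ j, ‖c j‖ ≤ 1) {x : K} (hx : ‖x‖ < 1) : ‖psEval c x‖ ≤ 1 := by
  refine IsUltrametricDist.norm_tsum_le_of_forall_le_of_nonneg zero_le_one fun j ↦ ?_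
  rw [norm_mul, norm_pow]
  exact mul_le_one₀ (hc j) (by positivity) (pow_le_one₀ (norm_nonneg x) hx.le)

lemma psEval_eq_add_mul (hc : ∀ j, ‖c j‖ ≤ 1) {x : K} (hx : ‖x‖ < 1) :
    psEval c x = c 0 + x * psEval (fun j ↦ c (j + 1)) x := by
  rw [psEval, (summable_psEval hc hx).tsum_eq_zero_add, psEval, ← tsum_mul_left]
  simp only [pow_zero, mul_one, pow_succ]
  congr 2
  ext j
  ring

lemma norm_psEval_lt_one_iff (hc : ∀ j, ‖c j‖ ≤ 1) {x : K} (hx : ‖x‖ < 1) :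
    ‖psEval c x‖ < 1 ↔ ‖c 0‖ < 1 := by
  rw [psEval_eq_add_mul hc hx]
  apply norm_add_lt_iff_of_norm_lt
  rw [norm_mul]
  exact mul_lt_one_of_nonneg_of_lt_one_left (norm_nonneg x) hx
    (norm_psEval_le (fun j ↦ hc (j + 1)) hx)

lemma norm_psDerivEval_lt_one_iff (hc : ∀ j, ‖c j‖ ≤ 1) {x : K} (hx : ‖x‖ < 1) :
    ‖psDerivEval c x‖ < 1 ↔ ‖c 1‖ < 1 := by
  rw [psDerivEval_eq_psEval,
    norm_psEval_lt_one_iff (fun j ↦ norm_natCast_mul_le_one hc (j + 1) (j + 1)) hx]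
  simp

lemma hasSum_psEval_taylor_remainder (hc : ∀ j, ‖c j‖ ≤ 1) {t b : K} (ht : ‖t‖ < 1)
    (hb : ‖b‖ < 1) :
    HasSum (fun n : ℕ ↦ c (n + 2) *
        (b ^ (n + 2) - ((n + 2 : ℕ) : K) * t ^ (n + 1) * (b - t) - t ^ (n + 2)))
      (psEval c b - psDerivEval c t * (b - t) - psEval c t) := by
  have hB := (hasSum_nat_add_iff' 2).mpr (summable_psEval hc hb).hasSum
  have hT := (hasSum_nat_add_iff' 2).mpr (summable_psEval hc ht).hasSum
  have hD := ((hasSum_nat_add_iff' 1).mpr (summable_psEval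
    (fun j ↦ norm_natCast_mul_le_one hc (j + 1) (j + 1)) ht).hasSum).mul_right (b - t)
  have hval : psEval c b - psDerivEval c t * (b - t) - psEval c t =
      (∑' j, c j * b ^ j - ∑ j ∈ Finset.range 2, c j * b ^ j)
        - (∑' j, ((j + 1 : ℕ) : K) * c (j + 1) * t ^ j
          - ∑ j ∈ Finset.range 1, ((j + 1 : ℕ) : K) * c (j + 1) * t ^ j) * (b - t)
        - (∑' j, c j * t ^ j - ∑ j ∈ Finset.range 2, c j * t ^ j) := by
    simp only [psEval, psDerivEval, Finset.sum_range_succ, Finset.sum_range_zero]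
    push_cast
    ring
  rw [hval]
  refine ((hB.sub hD).sub hT).congr_fun fun n ↦ ?_
  push_cast
  ring

lemma norm_psEval_taylor_remainder_lt_iff (hc : ∀ j, ‖c j‖ ≤ 1) {t b : K} (ht : ‖t‖ < 1)
    (hb : ‖b‖ < 1) (hne : b ≠ t) :
    ‖psEval c b - psDerivEval c t * (b - t) - psEval c t‖ < ‖b - t‖ ^ 2 ↔ ‖c 2‖ < 1 := by
  have hh : 0 < ‖b - t‖ ^ 2 := by
    have := norm_pos_iff.mpr (sub_ne_zero.mpr hne)
    positivity
  obtain ⟨r, htr, hbr, hr⟩ : ∃ r, ‖t‖ ≤ r ∧ ‖b‖ ≤ r ∧ r < 1 :=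
    ⟨max ‖t‖ ‖b‖, le_max_left _ _, le_max_right _ _, max_lt ht hb⟩
  have hr0 : 0 ≤ r := (norm_nonneg t).trans htr
  have hsum := hasSum_psEval_taylor_remainder hc ht hb
  rw [← hsum.tsum_eq, hsum.summable.tsum_eq_zero_add, norm_add_lt_iff_of_norm_lt]
  · rw [show c (0 + 2) * (b ^ (0 + 2) - ((0 + 2 : ℕ) : K) * t ^ (0 + 1) * (b - t) - t ^ (0 + 2))
      = c 2 * (b - t) ^ 2 by push_cast; ring, norm_mul, norm_pow]
    exact mul_lt_iff_lt_one_left hh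
  · refine lt_of_le_of_lt (IsUltrametricDist.norm_tsum_le_of_forall_le_of_nonneg
      (C := r * ‖b - t‖ ^ 2) (by positivity) fun n ↦ ?_) (mul_lt_of_lt_one_left hh hr)
    rw [norm_mul]
    refine (mul_le_of_le_one_left (norm_nonneg _) (hc _)).trans
      ((norm_pow_taylor_remainder_le htr hbr (n + 1)).trans ?_)
    gcongr
    exact pow_le_of_le_one hr0 hr.le n.succ_ne_zero

end PowerSeriesEstimates

lemma two_lt_lambdaInvariant_iff {K : Type*} [NormedField K] {c : ℕ → K}
    (hc : ∀ j, ‖c j‖ ≤ 1) (hμ : ∃ j, ‖c j‖ = 1) :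
    2 < lambdaInvariant c ↔ ‖c 0‖ < 1 ∧ ‖c 1‖ < 1 ∧ ‖c 2‖ < 1 := by
  constructor
  · intro h
    have key : ∀ j ≤ 2, ‖c j‖ < 1 := fun j hj ↦
      lt_of_le_of_ne (hc j) (Nat.notMem_of_lt_sInf (lt_of_le_of_lt hj h))
    exact ⟨key 0 (by omega), key 1 (by omega), key 2 (by omega)⟩
  · rintro ⟨h0, h1, h2⟩
    have hmem : ‖c (lambdaInvariant c)‖ = 1 := Nat.sInf_mem hμ
    by_contra! hle
    interval_cases lambdaInvariant c
    exacts [h0.ne hmem, h1.ne hmem, h2.ne hmem]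

/-- Let `p` be an odd prime, `K` a finite extension of `ℚ_p` with ring of
integers `O = {x | ‖x‖ ≤ 1}` and valuation normalized so that `v_p(p) = 1` (encoded via
the norm: `v_p(x) > r ↔ ‖x‖ < p^{-r}`).  Let `F ∈ O[[T]]` have vanishing μ-invariant and
λ-invariant `λ(F)`, `F'` its formal derivative, `t₀ ∈ O` with `v_p(t₀) > 0`, and `b ∈ O`
with `v_p(b - t₀) = 1`.  Then `λ(F) > 2` if and only if `v_p(F(t₀)) > 0`,
`v_p(F'(t₀)) > 0`, and `v_p(F(b) - F'(t₀)·(b - t₀) - F(t₀)) > 2`. -/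
theorem statement4
    (p : ℕ) (hp : p.Prime) (hodd : Odd p)
    (K : Type*) [NormedField K] [CompleteSpace K] [IsUltrametricDist K]
    [hpfact : Fact p.Prime] [Algebra ℚ_[p] K] [FiniteDimensional ℚ_[p] K]
    (hnorm : ∀ x : ℚ_[p], ‖algebraMap ℚ_[p] K x‖ = ‖x‖)
    (c : ℕ → K) (hc : ∀ j, ‖c j‖ ≤ 1) (hμ : ∃ j, ‖c j‖ = 1)
    (t₀ : K) (ht₀ : ‖t₀‖ < 1)
    (b : K) (hbt₀ : ‖b - t₀‖ = (p : ℝ)⁻¹) :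
    2 < lambdaInvariant c ↔
      (‖psEval c t₀‖ < 1 ∧ ‖psDerivEval c t₀‖ < 1 ∧
        ‖psEval c b - psDerivEval c t₀ * (b - t₀) - psEval c t₀‖ < (p : ℝ) ^ (-2 : ℤ)) := by
  have hp1 : (1 : ℝ) < p := by exact_mod_cast hp.one_lt
  have hlt : ‖b - t₀‖ < 1 := hbt₀ ▸ inv_lt_one_of_one_lt₀ hp1
  have hb : ‖b‖ < 1 := by
    rw [← sub_add_cancel b t₀]
    exact (norm_add_lt_iff_of_norm_lt ht₀).mpr hlt
  have hne : b ≠ t₀ := by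
    rintro rfl
    rw [sub_self, norm_zero] at hbt₀
    exact (inv_pos.mpr (zero_lt_one.trans hp1)).ne hbt₀
  have hsq : (p : ℝ) ^ (-2 : ℤ) = ‖b - t₀‖ ^ 2 := by
    rw [hbt₀, inv_pow, zpow_neg]
    norm_cast
  rw [two_lt_lambdaInvariant_iff hc hμ, norm_psEval_lt_one_iff hc ht₀,
    norm_psDerivEval_lt_one_iff hc ht₀, hsq, norm_psEval_taylor_remainder_lt_iff hc ht₀ hb hne]
end

section
/- Let p be an odd prime, K a finite extension of ℚ_p with ring of integers O, ramification index e over ℚ_p, and valuation v_p normalized so that v_p(p) = 1 (so v_p takes values in (1/e)ℤ on K^×). Let n ≥ 1 be an integer, let L be a finite extension of K containing a primitive p^n-th root of unity, with v_p extended to L, and let π_n ∈ L be a uniformizing element of ℚ_p(ζ_{p^n}), so that v_p(π_n) = 1/((p−1)p^{n−1}) (for example π_n = ζ_{p^n} − 1). Let F ∈ O[[T]] be a power series with vanishing μ-invariant and λ-invariant λ(F). Then λ(F) < (p−1)p^{n−1}/e if and only if v_p(F(π_n)) < 1/e, and in this case λ(F) = v_p(F(π_n)) · (p−1)p^{n−1}.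 -/
/-- If one term of a convergent sum in an ultrametric field strictly dominates a bound for all
the others, the sum has the norm of that term. -/
theorem norm_tsum_eq_of_dominant {L : Type*} [NormedField L] [IsUltrametricDist L]
    {f : ℕ → L} (hf : Summable f) {q : ℝ} (hq : 0 ≤ q) (k : ℕ)
    (h : ∀ j, j ≠ k → ‖f j‖ ≤ q) (hk : q < ‖f k‖) : ‖∑' j, f j‖ = ‖f k‖ := by
  rw [hf.tsum_eq_add_tsum_ite k]
  have hle : ‖∑' j, (if j = k then 0 else f j)‖ ≤ q := by
    refine IsUltrametricDist.norm_tsum_le_of_forall_le_of_nonneg hq fun j => ?_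
    split_ifs with hj
    · simpa using hq
    · exact h j hj
  rw [IsUltrametricDist.norm_add_eq_max_of_norm_ne_norm (hle.trans_lt hk).ne',
    max_eq_left (hle.trans hk.le)]

/-- Let `p` be an odd prime, `K` a finite extension of `ℚ_p` with ring of
integers `O`, ramification index `e` over `ℚ_p`, and valuation `v_p` normalized so that
`v_p(p) = 1` (encoded via the norm: `v_p(x) = r ↔ ‖x‖ = p^{-r}`, so `v_p` takes values
in `(1/e)ℤ` on `K^×`).  Let `n ≥ 1`, let `L/K` be a finite extension containing a
primitive `p^n`-th root of unity (norm extending that of `K`), and let `π ∈ L` be a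
uniformizer of `ℚ_p(ζ_{p^n})`, i.e. `v_p(π) = 1/((p-1)p^{n-1})`.  Let `F ∈ O[[T]]` have
vanishing μ-invariant and λ-invariant `λ(F)`.  Then
`λ(F) < (p-1)p^{n-1}/e ↔ v_p(F(π)) < 1/e`, and in this case
`λ(F) = v_p(F(π))·(p-1)p^{n-1}`. -/
theorem statement5
    (p : ℕ) (hp : p.Prime) (hodd : Odd p)
    (K : Type*) [NormedField K] [CompleteSpace K] [IsUltrametricDist K]
    [hpfact : Fact p.Prime] [Algebra ℚ_[p] K] [FiniteDimensional ℚ_[p] K]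
    (hnormK : ∀ x : ℚ_[p], ‖algebraMap ℚ_[p] K x‖ = ‖x‖)
    (e : ℕ) (he : 0 < e)
    (hram : ∀ x : K, x ≠ 0 → ∃ m : ℤ, ‖x‖ = (p : ℝ) ^ (-(m : ℝ) / (e : ℝ)))
    (hunif : ∃ x : K, ‖x‖ = (p : ℝ) ^ (-(1 : ℝ) / (e : ℝ)))
    (n : ℕ) (hn : 1 ≤ n)
    (L : Type*) [NormedField L] [CompleteSpace L] [IsUltrametricDist L]
    [Algebra K L] [FiniteDimensional K L]
    (hnormL : ∀ x : K, ‖algebraMap K L x‖ = ‖x‖)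
    (hroot : ∃ ζ : L, IsPrimitiveRoot ζ (p ^ n))
    (π : L) (hπ : ‖π‖ = (p : ℝ) ^ (-(1 : ℝ) / (((p : ℝ) - 1) * (p : ℝ) ^ (n - 1))))
    (c : ℕ → K) (hc : ∀ j, ‖c j‖ ≤ 1) (hμ : ∃ j, ‖c j‖ = 1) :
    ((lambdaInvariant c : ℝ) < ((p : ℝ) - 1) * (p : ℝ) ^ (n - 1) / (e : ℝ) ↔
      (p : ℝ) ^ (-(1 : ℝ) / (e : ℝ)) < ‖∑' j : ℕ, algebraMap K L (c j) * π ^ j‖) ∧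
    ((lambdaInvariant c : ℝ) < ((p : ℝ) - 1) * (p : ℝ) ^ (n - 1) / (e : ℝ) →
      ‖∑' j : ℕ, algebraMap K L (c j) * π ^ j‖ =
        (p : ℝ) ^ (-(lambdaInvariant c : ℝ) / (((p : ℝ) - 1) * (p : ℝ) ^ (n - 1)))) := by
  have hp1 : (1 : ℝ) < p := by exact_mod_cast hp.one_lt
  have hp0 : (0 : ℝ) < p := by linarith
  have he' : (0 : ℝ) < e := by exact_mod_cast he
  set N : ℝ := ((p : ℝ) - 1) * (p : ℝ) ^ (n - 1) with hN
  have hN0 : 0 < N := mul_pos (by linarith) (by positivity)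
  set q : ℝ := (p : ℝ) ^ (-(1 : ℝ) / (e : ℝ)) with hq
  have hq0 : 0 ≤ q := by positivity
  set l := lambdaInvariant c with hl
  have hcl : ‖c l‖ = 1 := Nat.sInf_mem (s := {j | ‖c j‖ = 1}) hμ
  have hsmall : ∀ j < l, ‖c j‖ ≤ q := fun j hj => by
    have hne : ‖c j‖ ≠ 1 := Nat.notMem_of_lt_sInf (s := {j | ‖c j‖ = 1}) hj
    by_cases h0 : c j = 0
    · simpa [h0] using hq0
    obtain ⟨m, hm⟩ := hram _ h0
    have hlt : ‖c j‖ < 1 := lt_of_le_of_ne (hc j) hne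
    have hm1 : 1 ≤ m := by
      by_contra! hm0
      have hm' : (m : ℝ) ≤ 0 := by exact_mod_cast (by omega : m ≤ 0)
      have : 1 ≤ ‖c j‖ := hm ▸ Real.one_le_rpow hp1.le (div_nonneg (by linarith) he'.le)
      linarith
    have hm' : (1 : ℝ) ≤ m := by exact_mod_cast hm1
    rw [hm, hq]
    exact Real.rpow_le_rpow_of_exponent_le hp1.le (by gcongr)
  have hπ1 : ‖π‖ < 1 := by
    rw [hπ]
    exact Real.rpow_lt_one_of_one_lt_of_neg hp1 (div_neg_of_neg_of_pos (by norm_num) hN0)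
  have hπ0 : 0 < ‖π‖ := by rw [hπ]; positivity
  have hpow : ∀ j : ℕ, ‖π‖ ^ j = (p : ℝ) ^ (-(j : ℝ) / N) := fun j => by
    rw [hπ, ← Real.rpow_mul_natCast hp0.le]
    congr 1
    ring
  set f : ℕ → L := fun j => algebraMap K L (c j) * π ^ j with hf
  have hfn : ∀ j, ‖f j‖ = ‖c j‖ * ‖π‖ ^ j := fun j => by simp [hf, hnormL]
  have hfl : ‖f l‖ = ‖π‖ ^ l := by rw [hfn, hcl, one_mul]
  have hfle : ∀ j, ‖f j‖ ≤ ‖π‖ ^ j := fun j => by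
    rw [hfn]
    exact mul_le_of_le_one_left (by positivity) (hc j)
  have hsum : Summable f :=
    .of_norm_bounded (summable_geometric_of_lt_one hπ0.le hπ1) hfle
  have hflt : ∀ j < l, ‖f j‖ ≤ q := fun j hj => by
    rw [hfn]
    exact (mul_le_of_le_one_right (norm_nonneg _) (pow_le_one₀ hπ0.le hπ1.le)).trans
      (hsmall j hj)
  have hiff : (l : ℝ) < N / e ↔ q < ‖π‖ ^ l := by
    rw [hpow, hq, Real.rpow_lt_rpow_left_iff hp1, neg_div, neg_div, neg_lt_neg_iff,
      div_lt_div_iff₀ hN0 he', lt_div_iff₀ he', one_mul]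
  have hmain : (l : ℝ) < N / e → ‖∑' j, f j‖ = ‖π‖ ^ l := fun h => by
    rw [← hfl]
    refine norm_tsum_eq_of_dominant hsum (q := max q (‖π‖ ^ (l + 1)))
      (le_max_of_le_left hq0) l (fun j hj => ?_) ?_
    · rcases lt_or_gt_of_ne hj with hj | hj
      · exact le_max_of_le_left (hflt j hj)
      · exact le_max_of_le_right
          ((hfle j).trans (pow_le_pow_of_le_one hπ0.le hπ1.le hj))
    · rw [hfl]
      exact max_lt (hiff.1 h) (pow_lt_pow_right_of_lt_one₀ hπ0 hπ1 l.lt_succ_self)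
  refine ⟨⟨fun h => by rw [hmain h]; exact hiff.1 h, fun h => ?_⟩,
    fun h => by rw [hmain h, hpow]⟩
  by_contra hge
  have hle : ‖π‖ ^ l ≤ q := not_lt.1 (mt hiff.2 hge)
  refine h.not_ge (IsUltrametricDist.norm_tsum_le_of_forall_le_of_nonneg hq0 fun j => ?_)
  rcases lt_or_ge j l with hj | hj
  · exact hflt j hj
  · exact ((hfle j).trans (pow_le_pow_of_le_one hπ0.le hπ1.le hj)).trans hle
end
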